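/- The rank 16 even unimodular positive definite forms S(8)⊕S(8) and S(16) are not integrally equivalent: there is no U ∈ GL(16,ℤ) with ᵗU·(S(8)⊕S(8))·U = S(16), where S(8) is the Gram matrix of the E₈ lattice and S(16) is the Gram matrix of the D₁₆⁺ lattice. -/

import Mathlib

open scoped Matrix BigOperators
open Matrix

noncomputable section

/-- The standard Gram matrix `S(8)` of the E₈ root lattice: the (symmetric) Cartan
matrix of E₈, i.e. `2` on the diagonal and `−1` exactly at the pairs of indices joined
by an edge of the E₈ Dynkin diagram (a chain `0—1—2—3—4—5—6` with the node `7`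
attached to node `2`).  It is even, positive definite, of determinant `1`. -/
def E8Gram : Matrix (Fin 8) (Fin 8) ℤ := fun i j =>
  if i = j then 2
  else if (i.val, j.val) ∈ ([(0,1),(1,2),(2,3),(3,4),(4,5),(5,6),(2,7)] : List (ℕ × ℕ)) ∨
      (j.val, i.val) ∈ ([(0,1),(1,2),(2,3),(3,4),(4,5),(5,6),(2,7)] : List (ℕ × ℕ))
    then -1 else 0

/-- The `16 × 16` block diagonal matrix `S(8) ⊕ S(8)`. -/
def E8E8Gram : Matrix (Fin 16) (Fin 16) ℤ :=
  Matrix.reindex finSumFinEquiv finSumFinEquiv (Matrix.fromBlocks E8Gram 0 0 E8Gram)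

/-- The standard Gram matrix `S(16)` of the lattice `D₁₆⁺ = D₁₆ ∪ (D₁₆ + s)`,
`s = (1/2,…,1/2)`, with respect to the basis `2e₁, e₂−e₁, …, e₁₅−e₁₄, s`.
It is even, positive definite, of determinant `1`. -/
def D16plusGram : Matrix (Fin 16) (Fin 16) ℤ := fun i j =>
  if i = j then (if i = 0 ∨ i = 15 then 4 else 2)
  else if (i = 0 ∧ j = 15) ∨ (i = 15 ∧ j = 0) then 1
  else if i.val + 1 = j.val ∨ j.val + 1 = i.val then
    (if i = 0 ∨ j = 0 then -2 else if i = 15 ∨ j = 15 then 0 else -1)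
  else 0

/-- A sum-of-squares decomposition of `60` times the E₈ form. -/
theorem E8Gram_sum_of_squares (x : Fin 8 → ℤ) :
    60 * (x ⬝ᵥ E8Gram *ᵥ x) =
      30 * (2 * x 0 - x 1) ^ 2 + 10 * (3 * x 1 - 2 * x 2) ^ 2 + 30 * (2 * x 7 - x 2) ^ 2 +
      30 * (2 * x 6 - x 5) ^ 2 + 10 * (3 * x 5 - 2 * x 4) ^ 2 + 5 * (4 * x 4 - 3 * x 3) ^ 2 +
      3 * (5 * x 3 - 4 * x 2) ^ 2 + 2 * x 2 ^ 2 := by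
  simp [dotProduct, mulVec, Fin.sum_univ_eight, E8Gram]
  ring

theorem E8Gram_even (x : Fin 8 → ℤ) : Even (x ⬝ᵥ E8Gram *ᵥ x) := by
  refine ⟨x 0 ^ 2 + x 1 ^ 2 + x 2 ^ 2 + x 3 ^ 2 + x 4 ^ 2 + x 5 ^ 2 + x 6 ^ 2 + x 7 ^ 2 -
    (x 0 * x 1 + x 1 * x 2 + x 2 * x 3 + x 3 * x 4 + x 4 * x 5 + x 5 * x 6 + x 2 * x 7), ?_⟩
  simp [dotProduct, mulVec, Fin.sum_univ_eight, E8Gram]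
  ring

theorem E8Gram_nonneg (x : Fin 8 → ℤ) : 0 ≤ x ⬝ᵥ E8Gram *ᵥ x := by
  have h := E8Gram_sum_of_squares x
  have : 0 ≤ 60 * (x ⬝ᵥ E8Gram *ᵥ x) := by rw [h]; positivity
  omega

theorem E8Gram_anisotropic {x : Fin 8 → ℤ} (hx : x ⬝ᵥ E8Gram *ᵥ x = 0) : x = 0 := by
  have h := E8Gram_sum_of_squares x
  rw [hx] at h
  have h0 := sq_nonneg (2 * x 0 - x 1)
  have h1 := sq_nonneg (3 * x 1 - 2 * x 2)
  have h7 := sq_nonneg (2 * x 7 - x 2)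
  have h6 := sq_nonneg (2 * x 6 - x 5)
  have h5 := sq_nonneg (3 * x 5 - 2 * x 4)
  have h4 := sq_nonneg (4 * x 4 - 3 * x 3)
  have h3 := sq_nonneg (5 * x 3 - 4 * x 2)
  have h2 := sq_nonneg (x 2)
  have e0 : 2 * x 0 - x 1 = 0 := sq_eq_zero_iff.mp (by linarith)
  have e1 : 3 * x 1 - 2 * x 2 = 0 := sq_eq_zero_iff.mp (by linarith)
  have e7 : 2 * x 7 - x 2 = 0 := sq_eq_zero_iff.mp (by linarith)
  have e6 : 2 * x 6 - x 5 = 0 := sq_eq_zero_iff.mp (by linarith)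
  have e5 : 3 * x 5 - 2 * x 4 = 0 := sq_eq_zero_iff.mp (by linarith)
  have e4 : 4 * x 4 - 3 * x 3 = 0 := sq_eq_zero_iff.mp (by linarith)
  have e3 : 5 * x 3 - 4 * x 2 = 0 := sq_eq_zero_iff.mp (by linarith)
  have e2 : x 2 = 0 := sq_eq_zero_iff.mp (by linarith)
  funext i
  fin_cases i <;> simp <;> omega

/-- A root of `E₈ ⊕ E₈` lies in one of the two summands. -/
theorem E8Gram_root_split {x y : Fin 8 → ℤ}
    (h : x ⬝ᵥ E8Gram *ᵥ x + y ⬝ᵥ E8Gram *ᵥ y = 2) : x = 0 ∨ y = 0 := by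
  obtain ⟨m, hm⟩ := E8Gram_even x
  obtain ⟨n, hn⟩ := E8Gram_even y
  have hx := E8Gram_nonneg x
  have hy := E8Gram_nonneg y
  rcases (show m = 0 ∨ n = 0 by omega) with rfl | rfl
  · exact .inl (E8Gram_anisotropic (by simpa using hm))
  · exact .inr (E8Gram_anisotropic (by simpa using hn))

/-- If the stacked matrix with blocks `A`, `B` has a left inverse, then `B` cannot vanish on more
columns than `A` has rows. -/
theorem card_le_of_left_inverse_of_cols_eq_zero {m m' n k : Type*} [Fintype m] [Fintype m']
    [Fintype n] [DecidableEq n] [Fintype k] {A : Matrix m n ℤ} {B : Matrix m' n ℤ}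
    {C : Matrix n m ℤ} {D : Matrix n m' ℤ} (h : C * A + D * B = 1) (f : k ↪ n)
    (hB : ∀ j, B.col (f j) = 0) : Fintype.card k ≤ Fintype.card m := by
  classical
  have hB' : B.submatrix id f = 0 := by
    ext i j
    exact congrFun (hB j) i
  have key : C.submatrix f id * A.submatrix id f = 1 := by
    have := congrArg (fun M => M.submatrix f f) h
    simpa [submatrix_add, submatrix_mul _ _ f id f Function.bijective_id, hB',
      submatrix_one f f.injective] using this
  have h1 := rank_mul_le_right (C.submatrix f id) (A.submatrix id f)
  rw [key, rank_one] at h1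
  exact h1.trans (rank_le_card_height _)

theorem transpose_mul_mul_apply_cols {m n R : Type*} [Fintype m] [NonUnitalSemiring R]
    (A : Matrix m n R) (E : Matrix m m R) (i j : n) :
    (Aᵀ * E * A) i j = A.col i ⬝ᵥ E *ᵥ A.col j := by
  rw [Matrix.mul_assoc]
  rfl

/-- The rank 16 even unimodular positive definite forms `S(8) ⊕ S(8)` and `S(16)` are
not integrally equivalent: there is no `U ∈ GL(16,ℤ)` with `ᵗU·(S(8)⊕S(8))·U = S(16)`. -/
theorem E8E8_not_equivalent_D16plus :
    ¬ ∃ U : Matrix (Fin 16) (Fin 16) ℤ, IsUnit U.det ∧ Uᵀ * E8E8Gram * U = D16plusGram := by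
  rintro ⟨U, hU, hG⟩
  let e : Fin 8 ⊕ Fin 8 ≃ Fin 16 := finSumFinEquiv
  obtain ⟨A, B, hAB⟩ : ∃ A B : Matrix (Fin 8) (Fin 16) ℤ, U.submatrix e id = fromRows A B :=
    ⟨_, _, (fromRows_toRows _).symm⟩
  obtain ⟨C, D, hCD⟩ : ∃ C D : Matrix (Fin 16) (Fin 8) ℤ, U⁻¹.submatrix id e = fromCols C D :=
    ⟨_, _, (fromCols_toCols _).symm⟩
  have hinv : C * A + D * B = 1 := by
    rw [← fromCols_mul_fromRows, ← hCD, ← hAB, submatrix_mul_equiv, nonsing_inv_mul _ hU,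
      submatrix_id_id]
  have hsum : Aᵀ * E8Gram * A + Bᵀ * E8Gram * B = D16plusGram := by
    have hE : E8E8Gram.submatrix e e = fromBlocks E8Gram 0 0 E8Gram := by
      ext i j
      simp [E8E8Gram, e]
    have h : (fromRows A B)ᵀ * fromBlocks E8Gram 0 0 E8Gram * fromRows A B = D16plusGram := by
      rw [← hAB, ← hE, transpose_submatrix, submatrix_mul_equiv, submatrix_mul_equiv, hG,
        submatrix_id_id]
    simpa [transpose_fromRows, fromCols_mul_fromBlocks, fromCols_mul_fromRows] using h
  have hgram (i j : Fin 16) : A.col i ⬝ᵥ E8Gram *ᵥ A.col j + B.col i ⬝ᵥ E8Gram *ᵥ B.col j =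
      D16plusGram i j := by
    rw [← hsum, Matrix.add_apply, transpose_mul_mul_apply_cols, transpose_mul_mul_apply_cols]
  let f : Fin 14 ↪ Fin 16 := (Fin.castSuccEmb.trans (Fin.succEmb 15))
  have hdiag (k : Fin 14) : D16plusGram (f k) (f k) = 2 := by
    revert k
    decide
  have hnext (k : Fin 13) : D16plusGram (f k.castSucc) (f k.succ) = -1 := by
    revert k
    decide
  have hsplit (k : Fin 14) : A.col (f k) = 0 ∨ B.col (f k) = 0 :=
    E8Gram_root_split ((hgram _ _).trans (hdiag k))
  rcases hsplit 0 with h0 | h0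
  · have hA (k : Fin 14) : A.col (f k) = 0 := by
      induction k using Fin.induction with
      | zero => exact h0
      | succ k ih =>
        refine (hsplit k.succ).resolve_right fun hB => ?_
        have := (hgram _ _).trans (hnext k)
        simp [ih, hB] at this
    have := card_le_of_left_inverse_of_cols_eq_zero ((add_comm _ _).trans hinv) f hA
    simp at this
  · have hB (k : Fin 14) : B.col (f k) = 0 := by
      induction k using Fin.induction with
      | zero => exact h0
      | succ k ih =>
        refine (hsplit k.succ).resolve_left fun hA => ?_
        have := (hgram _ _).trans (hnext k)
        simp [ih, hA] at this
    have := card_le_of_left_inverse_of_cols_eq_zero hinv f hB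
    simp at this
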